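/- Capacity region for threshold access structures with pairwise secret keys (Theorem 7): in the pairwise-keys model, for every t ∈ {1,…,L} and z ∈ {1,…,t−1}, the capacity region is C(𝔸_t, 𝕌_z) = { (R_d)_{d∈𝒟} ∈ ℝ_{≥0}^D : Σ_{d∈S} R_d ≤ |S|·(t − z) for all S ⊆ 𝒟 }. Moreover, the rate tuple (R*_d)_{d∈𝒟} with R*_d = t − z for every d ∈ 𝒟 is achievable, i.e., each coordinate simultaneously attains its maximum over the region. -/

import Mathlib

open scoped BigOperators
open Finset Filter

noncomputable section

namespace SecretSharing

open scoped Classical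

/-! ### Basic Shannon information quantities (base 2) on finite probability spaces -/

variable {Ω : Type*} [Fintype Ω]

/-- `p` is a probability mass function on the finite type `Ω`. -/
def IsPMF (p : Ω → ℝ) : Prop := (∀ ω, 0 ≤ p ω) ∧ ∑ ω : Ω, p ω = 1

/-- Probability that the random variable `X` takes the value `a` under `p`. -/
def prob (p : Ω → ℝ) {A : Type*} (X : Ω → A) (a : A) : ℝ :=
  ∑ ω : Ω, if X ω = a then p ω else 0

/-- Shannon entropy (in bits) of the random variable `X` under `p`. -/
def ent (p : Ω → ℝ) {A : Type*} [Fintype A] (X : Ω → A) : ℝ :=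
  -∑ a : A, prob p X a * Real.logb 2 (prob p X a)

/-- Conditional Shannon entropy `H(X | Y)` in bits. -/
def condEnt (p : Ω → ℝ) {A B : Type*} [Fintype A] [Fintype B]
    (X : Ω → A) (Y : Ω → B) : ℝ :=
  ent p (fun ω => (X ω, Y ω)) - ent p Y

/-- Mutual information `I(X ; Y)` in bits. -/
def mutInf (p : Ω → ℝ) {A B : Type*} [Fintype A] [Fintype B]
    (X : Ω → A) (Y : Ω → B) : ℝ :=
  ent p X + ent p Y - ent p (fun ω => (X ω, Y ω))

/-- Conditional mutual information `I(X ; Y | Z)` in bits. -/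
def condMutInf (p : Ω → ℝ) {A B C : Type*} [Fintype A] [Fintype B] [Fintype C]
    (X : Ω → A) (Y : Ω → B) (Z : Ω → C) : ℝ :=
  condEnt p X Z - condEnt p X (fun ω => (Y ω, Z ω))

/-! ### The distributed secret-sharing model -/

variable {L D : ℕ} {𝒳 : Fin L → Type} {𝒴 : Fin D → Type}
variable [∀ l, Fintype (𝒳 l)] [∀ d, Fintype (𝒴 d)]

/-- Sample space for one source symbol: the participants' observations and the
sub-dealers' observations. -/
abbrev Base (𝒳 : Fin L → Type) (𝒴 : Fin D → Type) : Type := (∀ l, 𝒳 l) × (∀ d, 𝒴 d)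

/-- The i.i.d. product pmf of `p` over `n` source symbols. -/
def iid (p : Base 𝒳 𝒴 → ℝ) (n : ℕ) : (Fin n → Base 𝒳 𝒴) → ℝ :=
  fun ω => ∏ i, p (ω i)

/-- Observations `X_T` of the set `T` of participants (single symbol). -/
def XT (T : Finset (Fin L)) : Base 𝒳 𝒴 → ∀ l : {l // l ∈ T}, 𝒳 l.1 :=
  fun ω l => ω.1 l.1

/-- Observations `Y_S` of the set `S` of sub-dealers (single symbol). -/
def YS (S : Finset (Fin D)) : Base 𝒳 𝒴 → ∀ d : {d // d ∈ S}, 𝒴 d.1 :=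
  fun ω d => ω.2 d.1

/-- Observations `X_T^n` of the set `T` of participants over a block of length `n`. -/
def XTn (T : Finset (Fin L)) (n : ℕ) :
    (Fin n → Base 𝒳 𝒴) → ∀ l : {l // l ∈ T}, Fin n → 𝒳 l.1 :=
  fun ω l i => (ω i).1 l.1

/-- Cardinality `⌈2^{n R_d}⌉` of the secret alphabet of sub-dealer `d`. -/
def secCard (R : Fin D → ℝ) (n : ℕ) (d : Fin D) : ℕ := ⌈(2:ℝ) ^ ((n : ℝ) * R d)⌉₊

/-- A secret-sharing strategy at blocklength `n` with rates `R`, for the access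
structure `𝔸`: public messages, secrets, and decoders for authorized sets. -/
structure Strategy (𝒳 : Fin L → Type) (𝒴 : Fin D → Type)
    (𝔸 : Set (Finset (Fin L))) (R : Fin D → ℝ) (n : ℕ) where
  msgCard : Fin D → ℕ
  encM : ∀ d : Fin D, (Fin n → 𝒴 d) → Fin (msgCard d)
  encS : ∀ d : Fin D, (Fin n → 𝒴 d) → Fin (secCard R n d)
  dec : ∀ A : Finset (Fin L), A ∈ 𝔸 →
    (∀ l : {l // l ∈ A}, Fin n → 𝒳 l.1) → (∀ d, Fin (msgCard d)) →
      ∀ d, Fin (secCard R n d)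

variable {𝔸 : Set (Finset (Fin L))} {R : Fin D → ℝ} {n : ℕ}

/-- The public communication `M_𝒟` as a random variable. -/
def Strategy.Mrv (σ : Strategy 𝒳 𝒴 𝔸 R n) :
    (Fin n → Base 𝒳 𝒴) → ∀ d, Fin (σ.msgCard d) :=
  fun ω d => σ.encM d (fun i => (ω i).2 d)

/-- The secrets `S_𝒟` as a random variable. -/
def Strategy.Srv (σ : Strategy 𝒳 𝒴 𝔸 R n) :
    (Fin n → Base 𝒳 𝒴) → ∀ d, Fin (secCard R n d) :=
  fun ω d => σ.encS d (fun i => (ω i).2 d)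

/-- The estimate `Ŝ_𝒟(A)` computed by the authorized set `A`. -/
def Strategy.ShatRv (σ : Strategy 𝒳 𝒴 𝔸 R n) (A : Finset (Fin L)) (hA : A ∈ 𝔸) :
    (Fin n → Base 𝒳 𝒴) → ∀ d, Fin (secCard R n d) :=
  fun ω => σ.dec A hA (fun l i => (ω i).1 l.1) (σ.Mrv ω)

/-- Error probability `P[Ŝ_𝒟(A) ≠ S_𝒟]`. -/
def Strategy.err (p : Base 𝒳 𝒴 → ℝ) (σ : Strategy 𝒳 𝒴 𝔸 R n)
    (A : Finset (Fin L)) (hA : A ∈ 𝔸) : ℝ :=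
  ∑ ω : Fin n → Base 𝒳 𝒴, if σ.ShatRv A hA ω ≠ σ.Srv ω then iid p n ω else 0

/-- Information leakage `I(S_𝒟 ; M_𝒟, X_U^n)` to the set `U` of participants. -/
def Strategy.leak (p : Base 𝒳 𝒴 → ℝ) (σ : Strategy 𝒳 𝒴 𝔸 R n)
    (U : Finset (Fin L)) : ℝ :=
  mutInf (iid p n) σ.Srv (fun ω => (σ.Mrv ω, XTn U n ω))

/-- Uniformity defect `log₂|𝒮_𝒟| - H(S_𝒟)`. -/
def Strategy.unif (p : Base 𝒳 𝒴 → ℝ) (σ : Strategy 𝒳 𝒴 𝔸 R n) : ℝ :=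
  Real.logb 2 (∏ d, (secCard R n d : ℝ)) - ent (iid p n) σ.Srv

/-- Achievability of the rate tuple `R` for access structure `𝔸` and
unauthorized sets `𝕌`: a sequence of strategies with vanishing error
probability (for every authorized set), vanishing leakage (for every
unauthorized set), and vanishing uniformity defect. -/
def Achievable (p : Base 𝒳 𝒴 → ℝ) (𝔸 𝕌 : Set (Finset (Fin L)))
    (R : Fin D → ℝ) : Prop :=
  (∀ d, 0 ≤ R d) ∧
  ∃ σ : (n : ℕ) → Strategy 𝒳 𝒴 𝔸 R n,
    (∀ A : Finset (Fin L), ∀ hA : A ∈ 𝔸,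
      Tendsto (fun n => (σ n).err p A hA) atTop (nhds 0)) ∧
    (∀ U ∈ 𝕌, Tendsto (fun n => (σ n).leak p U) atTop (nhds 0)) ∧
    Tendsto (fun n => (σ n).unif p) atTop (nhds 0)

/-- `𝔸` is a monotone access structure: nonempty, not containing `∅`, and
closed under taking supersets. -/
def MonotoneAccess (𝔸 : Set (Finset (Fin L))) : Prop :=
  𝔸.Nonempty ∧ ∅ ∉ 𝔸 ∧ ∀ A ∈ 𝔸, ∀ T : Finset (Fin L), A ⊆ T → T ∈ 𝔸

/-- The pairwise-keys source: each participant `l` and sub-dealer `d` share an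
independent uniform key bit `K_{l,d}`; participant `l` observes `X_l = (K_{l,d})_d`
and sub-dealer `d` observes `Y_d = (K_{l,d})_l`. -/
def pairKeyPMF (L D : ℕ) :
    Base (fun _ : Fin L => Fin D → Bool) (fun _ : Fin D => Fin L → Bool) → ℝ :=
  fun ω => if ∀ (l : Fin L) (d : Fin D), ω.1 l d = ω.2 d l
    then ((1 : ℝ) / 2) ^ (L * D) else 0

/-! ### Helper lemmas -/

/-- The space of all keys. -/
abbrev Key (L D n : ℕ) : Type := Fin D → Fin L → Fin n → Bool

/-- The observations determined by the keys. -/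
def emb {L D n : ℕ} (κ : Key L D n) :
    Fin n → Base (fun _ : Fin L => Fin D → Bool) (fun _ : Fin D => Fin L → Bool) :=
  fun i => (fun l d => κ d l i, fun d l => κ d l i)

lemma emb_injective {L D n : ℕ} : Function.Injective (emb (L := L) (D := D) (n := n)) := by
  intro κ κ' h
  funext d l i
  have := congrFun h i
  have h2 := congrFun (congrFun (congrArg Prod.snd this) d) l
  exact h2

lemma iid_emb {L D n : ℕ} (κ : Key L D n) :
    iid (pairKeyPMF L D) n (emb κ) = 1 / (Fintype.card (Key L D n) : ℝ) := by
  have : Fintype.card (Key L D n) = 2 ^ (n * (L * D)) := by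
    simp [Key, ← pow_mul, mul_assoc]
  rw [this]
  simp only [iid, pairKeyPMF, emb, implies_true, if_true, Finset.prod_const, Finset.card_univ,
    Fintype.card_fin, ← pow_mul]
  rw [mul_comm (L * D) n]
  push_cast
  rw [one_div_pow]

lemma iid_not_emb {L D n : ℕ} (ω) (h : ω ∉ Set.range (emb (L := L) (D := D) (n := n))) :
    iid (pairKeyPMF L D) n ω = 0 := by
  unfold iid
  by_contra hne
  rw [← ne_eq, Finset.prod_ne_zero_iff] at hne
  apply h
  refine ⟨fun d l i => (ω i).2 d l, ?_⟩
  funext i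
  have hi := hne i (Finset.mem_univ _)
  unfold pairKeyPMF at hi
  have hc : ∀ (l : Fin L) (d : Fin D), (ω i).1 l d = (ω i).2 d l := by
    by_contra hcon
    rw [if_neg hcon] at hi
    exact hi rfl
  refine Prod.ext ?_ rfl
  funext l d
  exact (hc l d).symm

lemma sum_iid {L D n : ℕ} (f : (Fin n → Base (fun _ : Fin L => Fin D → Bool)
      (fun _ : Fin D => Fin L → Bool)) → Prop) [DecidablePred f] :
    (∑ ω, if f ω then iid (pairKeyPMF L D) n ω else 0) =
      ∑ κ : Key L D n, if f (emb κ) then 1 / (Fintype.card (Key L D n) : ℝ) else 0 := by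
  symm
  apply Fintype.sum_of_injective emb emb_injective
  · intro ω h
    rw [iid_not_emb ω h]; simp
  · intro κ
    rw [iid_emb]

/-- The uniform pmf. -/
def unifp (K : Type*) [Fintype K] : K → ℝ := fun _ => 1 / (Fintype.card K : ℝ)

lemma prob_iid {L D n : ℕ} {A : Type*} (X : (Fin n → Base (fun _ : Fin L => Fin D → Bool)
      (fun _ : Fin D => Fin L → Bool)) → A) (a : A) :
    prob (iid (pairKeyPMF L D) n) X a = prob (unifp (Key L D n)) (fun κ => X (emb κ)) a := by
  unfold prob
  rw [sum_iid]
  rfl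

lemma ent_iid {L D n : ℕ} {A : Type*} [Fintype A]
    (X : (Fin n → Base (fun _ : Fin L => Fin D → Bool)
      (fun _ : Fin D => Fin L → Bool)) → A) :
    ent (iid (pairKeyPMF L D) n) X = ent (unifp (Key L D n)) (fun κ => X (emb κ)) := by
  unfold ent
  simp_rw [prob_iid]

lemma isPMF_unifp (K : Type*) [Fintype K] [Nonempty K] : IsPMF (unifp K) := by
  constructor
  · intro ω; unfold unifp; positivity
  · simp [unifp]

section general

variable {K : Type*} [Fintype K] {p : K → ℝ}

lemma prob_nonneg (hp : IsPMF p) {A : Type*} (X : K → A) (a : A) : 0 ≤ prob p X a := by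
  unfold prob
  apply Finset.sum_nonneg
  intro ω _
  split_ifs
  · exact hp.1 ω
  · exact le_rfl

lemma sum_prob_mul {A : Type*} [Fintype A] (X : K → A) (f : A → ℝ) :
    ∑ a, prob p X a * f a = ∑ ω, p ω * f (X ω) := by
  unfold prob
  simp_rw [Finset.sum_mul]
  rw [Finset.sum_comm]
  apply Finset.sum_congr rfl
  intro ω _
  simp [ite_mul]

lemma sum_prob (hp : IsPMF p) {A : Type*} [Fintype A] (X : K → A) :
    ∑ a, prob p X a = 1 := by
  have := sum_prob_mul (p := p) X (fun _ => 1)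
  simpa [hp.2] using this

lemma sum_prob_fst {A B : Type*} [Fintype A] (X : K → A) (V : K → B) (b : B) :
    ∑ a, prob p (fun ω => (X ω, V ω)) (a, b) = prob p V b := by
  unfold prob
  rw [Finset.sum_comm]
  apply Finset.sum_congr rfl
  intro ω _
  by_cases h : V ω = b <;> simp [h]

/-- Entropy lower bound. -/
lemma ent_lower (hp : IsPMF p) {A : Type*} [Fintype A] (X : K → A) (q : ℝ)
    (hq : ∀ a, prob p X a ≤ q) : - Real.logb 2 q ≤ ent p X := by
  unfold ent
  apply neg_le_neg
  calc ∑ a, prob p X a * Real.logb 2 (prob p X a)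
      ≤ ∑ a, prob p X a * Real.logb 2 q := by
        apply Finset.sum_le_sum
        intro a _
        rcases (prob_nonneg hp X a).eq_or_lt with h | h
        · simp [← h]
        · exact mul_le_mul_of_nonneg_left (Real.logb_le_logb_of_le (by norm_num) h (hq a)) h.le
    _ = _ := by rw [← Finset.sum_mul, sum_prob hp, one_mul]

lemma ent_indep (hp : IsPMF p) {A B : Type*} [Fintype A] [Fintype B] (X : K → A) (V : K → B)
    (h : ∀ a b, prob p (fun ω => (X ω, V ω)) (a, b) = prob p X a * prob p V b) :
    ent p (fun ω => (X ω, V ω)) = ent p X + ent p V := by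
  unfold ent
  rw [Fintype.sum_prod_type]
  simp_rw [h]
  have key : ∀ a b, prob p X a * prob p V b * Real.logb 2 (prob p X a * prob p V b) =
      prob p V b * (prob p X a * Real.logb 2 (prob p X a)) +
      prob p X a * (prob p V b * Real.logb 2 (prob p V b)) := by
    intro a b
    by_cases ha : prob p X a = 0
    · simp [ha]
    by_cases hb : prob p V b = 0
    · simp [hb]
    rw [Real.logb_mul ha hb]; ring
  simp_rw [key, Finset.sum_add_distrib, ← Finset.sum_mul, ← Finset.mul_sum]
  rw [sum_prob hp V, ← Finset.sum_mul, sum_prob hp X]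
  ring

/-- Pointwise divergence inequality. -/
lemma kl_point (P V N c : ℝ) (hP : 0 ≤ P) (hPV : P ≤ V) (hN : 0 < N) (hc : 0 < c) :
    P * Real.log c + P - c * (V / N) ≤ P * Real.log P - P * Real.log V + P * Real.log N := by
  rcases hP.eq_or_lt with h | h
  · rw [← h]
    have : 0 ≤ c * (V / N) := mul_nonneg hc.le (div_nonneg (hP.trans hPV) hN.le)
    simp only [zero_mul]; linarith
  · have hV : 0 < V := h.trans_le hPV
    have h1 := Real.log_le_sub_one_of_pos (x := c * (V / N) / P) (by positivity)
    rw [Real.log_div (by positivity) (by positivity), Real.log_mul (by positivity) (by positivity),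
      Real.log_div (by positivity) (by positivity)] at h1
    have h2 := mul_le_mul_of_nonneg_left h1 h.le
    have h3 : P * (c * (V / N) / P - 1) = c * (V / N) - P := by field_simp
    rw [h3] at h2
    linarith

lemma kl_event (hp : IsPMF p) {A B : Type*} [Fintype A] [Fintype B] [Nonempty A]
    (X : K → A) (V : K → B) (E : A → B → Prop) (q : ℝ)
    (hq : ∀ b, (∑ a, if E a b then (1:ℝ) else 0) ≤ q * Fintype.card A) :
    (∑ ω, if E (X ω) (V ω) then p ω else 0) - q / Real.log 2 ≤
      Real.logb 2 (Fintype.card A) + ent p V - ent p (fun ω => (X ω, V ω)) := by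
  set N : ℝ := (Fintype.card A : ℝ) with hN
  have hNpos : 0 < N := by rw [hN]; exact_mod_cast Fintype.card_pos
  have hl : 0 < Real.log 2 := Real.log_pos (by norm_num)
  set P : A → B → ℝ := fun a b => prob p (fun ω => (X ω, V ω)) (a, b) with hPdef
  have hP0 : ∀ a b, 0 ≤ P a b := fun a b => prob_nonneg hp _ _
  have hsum : ∀ b, ∑ a, P a b = prob p V b := fun b => sum_prob_fst X V b
  have hPV : ∀ a b, P a b ≤ prob p V b := by
    intro a b
    rw [← hsum b]
    exact Finset.single_le_sum (fun a _ => hP0 a b) (Finset.mem_univ a)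
  have pt : ∀ a b, (if E a b then P a b else 0) * Real.log 2 + P a b - prob p V b / N
        - (if E a b then (1:ℝ) else 0) * (prob p V b / N)
      ≤ P a b * Real.log (P a b) - P a b * Real.log (prob p V b) + P a b * Real.log N := by
    intro a b
    by_cases hE : E a b
    · have := kl_point (P a b) (prob p V b) N 2 (hP0 a b) (hPV a b) hNpos (by norm_num)
      simp only [hE, if_true]; linarith
    · have := kl_point (P a b) (prob p V b) N 1 (hP0 a b) (hPV a b) hNpos (by norm_num)
      rw [Real.log_one] at this
      simp only [hE, if_false]; linarith
  have S : ∑ b, ∑ a, ((if E a b then P a b else 0) * Real.log 2 + P a b - prob p V b / N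
        - (if E a b then (1:ℝ) else 0) * (prob p V b / N)) ≤
      ∑ b, ∑ a, (P a b * Real.log (P a b) - P a b * Real.log (prob p V b) + P a b * Real.log N) :=
    Finset.sum_le_sum fun b _ => Finset.sum_le_sum fun a _ => pt a b
  have R1 : ∑ b, ∑ a, (P a b * Real.log (P a b) - P a b * Real.log (prob p V b)
      + P a b * Real.log N) =
      Real.log 2 * (Real.logb 2 N + ent p V - ent p (fun ω => (X ω, V ω))) := by
    simp_rw [Finset.sum_add_distrib, Finset.sum_sub_distrib, ← Finset.sum_mul, hsum,
      sum_prob hp V]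
    unfold ent
    rw [Fintype.sum_prod_type_right]
    simp only [Real.logb, ← mul_div_assoc, ← Finset.sum_div]
    field_simp
    ring
  have EV : ∑ b, ∑ a, (if E a b then P a b else 0) = ∑ ω, if E (X ω) (V ω) then p ω else 0 := by
    have := sum_prob_mul (p := p) (fun ω => (X ω, V ω)) (fun ab => if E ab.1 ab.2 then (1:ℝ) else 0)
    rw [Fintype.sum_prod_type_right] at this
    simpa using this
  have L1 : ∑ b, ∑ a, ((if E a b then P a b else 0) * Real.log 2 + P a b - prob p V b / N
        - (if E a b then (1:ℝ) else 0) * (prob p V b / N)) ≥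
      (∑ ω, if E (X ω) (V ω) then p ω else 0) * Real.log 2 - q := by
    have : ∑ b, ∑ a, ((if E a b then P a b else 0) * Real.log 2 + P a b - prob p V b / N
        - (if E a b then (1:ℝ) else 0) * (prob p V b / N)) =
        (∑ ω, if E (X ω) (V ω) then p ω else 0) * Real.log 2 -
        ∑ b, (∑ a, if E a b then (1:ℝ) else 0) * (prob p V b / N) := by
      rw [← EV]
      simp_rw [Finset.sum_sub_distrib, Finset.sum_add_distrib, hsum, ← Finset.sum_mul, sum_prob hp V]
      have : ∑ b : B, ∑ a : A, prob p V b / N = 1 := by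
        simp only [Finset.sum_const, Finset.card_univ, nsmul_eq_mul, ← hN]
        rw [← sum_prob hp V]
        refine Finset.sum_congr rfl fun b _ => ?_
        field_simp
      rw [this]; ring
    rw [this]
    have h2 : ∑ b, (∑ a, if E a b then (1:ℝ) else 0) * (prob p V b / N) ≤
        ∑ b, q * prob p V b := by
      refine Finset.sum_le_sum fun b _ => ?_
      calc _ ≤ (q * N) * (prob p V b / N) :=
            mul_le_mul_of_nonneg_right (hq b) (div_nonneg (prob_nonneg hp _ _) hNpos.le)
        _ = _ := by field_simp
    rw [← Finset.mul_sum, sum_prob hp V] at h2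
    linarith
  rw [R1] at S
  have := L1.trans S
  have h3 : (∑ ω, if E (X ω) (V ω) then p ω else 0) - q / Real.log 2 =
      ((∑ ω, if E (X ω) (V ω) then p ω else 0) * Real.log 2 - q) / Real.log 2 := by
    field_simp
  have h4 := (div_le_iff₀ hl).2 (this.trans_eq (mul_comm _ _))
  rw [← h3] at h4
  linarith

end general

lemma sum_update {ι : Type*} [Fintype ι] [DecidableEq ι] {β : ι → Type*} [∀ i, Fintype (β i)]
    (d : ι) (F : (∀ i, β i) → β d → ℝ) :
    ∑ s, ∑ r, F s r = ∑ s, ∑ r, F (Function.update s d r) (s d) := by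
  rw [← Fintype.sum_prod_type', ← Fintype.sum_prod_type']
  let e : ((∀ i, β i) × β d) ≃ ((∀ i, β i) × β d) :=
    { toFun := fun x => (Function.update x.1 d x.2, x.1 d)
      invFun := fun x => (Function.update x.1 d x.2, x.1 d)
      left_inv := by intro x; simp
      right_inv := by intro x; simp }
  exact (Equiv.sum_comp e (fun x : (∀ i, β i) × β d => F x.1 x.2)).symm

lemma secCard_pos {D : ℕ} (R : Fin D → ℝ) (n : ℕ) (d : Fin D) : 0 < secCard R n d := by
  unfold secCard
  exact Nat.ceil_pos.2 (by positivity)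

/-- The pairwise-keys strategies. -/
abbrev PStrategy (L D : ℕ) (𝔸 : Set (Finset (Fin L))) (R : Fin D → ℝ) (n : ℕ) :=
  Strategy (fun _ : Fin L => Fin D → Bool) (fun _ : Fin D => Fin L → Bool) 𝔸 R n

lemma leak_add_unif {L D n : ℕ} {𝔸 : Set (Finset (Fin L))} {R : Fin D → ℝ}
    (σ : PStrategy L D 𝔸 R n) (U : Finset (Fin L))
    (E : (∀ d, Fin (secCard R n d)) →
      ((∀ d, Fin (σ.msgCard d)) × (∀ _ : {l // l ∈ U}, Fin n → Fin D → Bool)) → Prop) (q : ℝ)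
    (hq : ∀ b, (∑ a, if E a b then (1:ℝ) else 0) ≤ q * ∏ d, (secCard R n d : ℝ)) :
    (∑ κ : Key L D n, if E (σ.Srv (emb κ)) (σ.Mrv (emb κ), XTn U n (emb κ))
        then unifp (Key L D n) κ else 0) - q / Real.log 2 ≤
      σ.leak (pairKeyPMF L D) U + σ.unif (pairKeyPMF L D) := by
  have : ∀ d, Nonempty (Fin (secCard R n d)) := fun d => ⟨⟨0, secCard_pos R n d⟩⟩
  have hc : (Fintype.card (∀ d, Fin (secCard R n d)) : ℝ) = ∏ d, (secCard R n d : ℝ) := by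
    simp
  have := kl_event (isPMF_unifp (Key L D n)) (fun κ => σ.Srv (emb κ))
    (fun κ => (σ.Mrv (emb κ), XTn U n (emb κ))) E q (by rw [hc]; exact hq)
  rw [hc] at this
  unfold Strategy.leak Strategy.unif mutInf
  rw [ent_iid, ent_iid, ent_iid]
  refine this.trans (le_of_eq ?_)
  ring

lemma count_list {D : ℕ} (M : Fin D → ℕ) (d : Fin D) (hd : 0 < M d) {K : Type*} [Fintype K]
    (f : K → Fin (M d)) (inst : ∀ a : (∀ d, Fin (M d)), Decidable (∃ k, f k = a d)) :
    (∑ a : (∀ d, Fin (M d)), if ∃ k, f k = a d then (1:ℝ) else 0) ≤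
      (Fintype.card K : ℝ) / M d * ∏ d, (M d : ℝ) := by
  have hM : (0:ℝ) < M d := by exact_mod_cast hd
  obtain ⟨h, hh⟩ : ∃ h : Fin (M d) → ℝ, ∀ r, h r = if r ∈ Finset.univ.image f then 1 else 0 :=
    ⟨_, fun r => rfl⟩
  have h0 : (∑ a : (∀ d, Fin (M d)), if ∃ k, f k = a d then (1:ℝ) else 0) =
      ∑ a : (∀ d, Fin (M d)), h (a d) := by
    refine Finset.sum_congr rfl fun a _ => ?_
    rw [hh]
    by_cases hk : ∃ k, f k = a d
    · rw [if_pos hk, if_pos (by simpa using hk)]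
    · rw [if_neg hk, if_neg (by simpa using hk)]
  have hle : ∑ r, h r ≤ Fintype.card K := by
    simp only [hh, Finset.sum_boole]
    rw [Finset.filter_univ_mem]
    exact_mod_cast (Finset.card_image_le (s := Finset.univ) (f := f)).trans_eq Finset.card_univ
  have hsum := sum_update d (fun (_ : ∀ d, Fin (M d)) (r : Fin (M d)) => h r)
  simp only [Finset.sum_const, Finset.card_univ, nsmul_eq_mul, ← Finset.mul_sum] at hsum
  rw [Fintype.card_pi] at hsum
  simp only [Fintype.card_fin] at hsum
  push_cast at hsum
  rw [h0, div_mul_eq_mul_div, le_div_iff₀ hM, mul_comm, ← hsum, mul_comm]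
  exact mul_le_mul_of_nonneg_right hle (Finset.prod_nonneg fun _ _ => Nat.cast_nonneg _)

lemma converse_step {L D n : ℕ} {𝔸 : Set (Finset (Fin L))} {R : Fin D → ℝ}
    (σ : PStrategy L D 𝔸 R n) (A : Finset (Fin L)) (hA : A ∈ 𝔸) (U : Finset (Fin L))
    (d : Fin D) :
    1 - σ.err (pairKeyPMF L D) A hA
      - ((2:ℝ) ^ (n * (A \ U).card) / secCard R n d) / Real.log 2 ≤
      σ.leak (pairKeyPMF L D) U + σ.unif (pairKeyPMF L D) := by
  set bad : Key L D n → ℝ := fun κ =>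
    if σ.ShatRv A hA (emb κ) ≠ σ.Srv (emb κ) then unifp (Key L D n) κ else 0 with hbad
  have herr : σ.err (pairKeyPMF L D) A hA = ∑ κ, bad κ := by
    unfold Strategy.err
    rw [sum_iid]
    rfl
  -- averaging over the keys of the other dealers
  obtain ⟨κ₀, -, hκ₀⟩ : ∃ κ₀ ∈ (Finset.univ : Finset (Key L D n)),
      (Fintype.card (Key L D n) : ℝ) * ∑ y, bad (Function.update κ₀ d y) ≤
        ∑ κ, ∑ y : Fin L → Fin n → Bool, bad (Function.update κ d y) := by
    by_contra hcon
    push Not at hcon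
    have := Finset.sum_lt_sum_of_nonempty (Finset.univ_nonempty) hcon
    rw [← Finset.mul_sum] at this
    simp only [Finset.sum_const, Finset.card_univ, nsmul_eq_mul] at this
    exact lt_irrefl _ this
  have hu1 : ∑ κ, ∑ y : Fin L → Fin n → Bool, bad (Function.update κ d y) =
      Fintype.card (Fin L → Fin n → Bool) * ∑ κ, bad κ := by
    rw [← sum_update d (fun (κ : Key L D n) (_ : Fin L → Fin n → Bool) => bad κ)]
    simp only [Finset.sum_const, Finset.card_univ, nsmul_eq_mul, Finset.mul_sum]
  have hu2 : (Fintype.card (Fin L → Fin n → Bool) : ℝ) *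
        ∑ κ : Key L D n, bad (Function.update κ₀ d (κ d)) =
      (Fintype.card (Key L D n) : ℝ) * ∑ y, bad (Function.update κ₀ d y) := by
    have := sum_update d (fun (_ : Key L D n) (y : Fin L → Fin n → Bool) =>
      bad (Function.update κ₀ d y))
    simp only [Finset.sum_const, Finset.card_univ, nsmul_eq_mul, ← Finset.mul_sum] at this
    exact this.symm
  have hbadle : ∑ κ : Key L D n, bad (Function.update κ₀ d (κ d)) ≤ ∑ κ, bad κ := by
    have hpos : (0:ℝ) < Fintype.card (Fin L → Fin n → Bool) := by
      exact_mod_cast Fintype.card_pos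
    refine le_of_mul_le_mul_left ?_ hpos
    rw [hu2, ← hu1]; exact hκ₀
  let lst : ((∀ d, Fin (σ.msgCard d)) × (∀ _ : {l // l ∈ U}, Fin n → Fin D → Bool)) →
      ({l // l ∈ A \ U} → Fin n → Bool) → Fin (secCard R n d) := fun v k =>
    σ.dec A hA (fun l i d' => if d' = d then
        (if h : l.1 ∈ U then v.2 ⟨l.1, h⟩ i d else k ⟨l.1, Finset.mem_sdiff.2 ⟨l.2, h⟩⟩ i)
        else κ₀ d' l.1 i)
      (Function.update (σ.Mrv (emb κ₀)) d (v.1 d)) d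
  have main := leak_add_unif σ U (fun s v => ∃ k, lst v k = s d)
    ((2:ℝ) ^ (n * (A \ U).card) / secCard R n d) ?_
  · refine le_trans ?_ main
    apply sub_le_sub_right
    rw [herr, sub_le_iff_le_add]
    refine le_trans ?_ (add_le_add_right hbadle _)
    rw [← Finset.sum_add_distrib, ← (isPMF_unifp (Key L D n)).2]
    refine Finset.sum_le_sum fun κ _ => ?_
    have hnn : 0 ≤ unifp (Key L D n) κ := (isPMF_unifp _).1 _
    by_cases hE : ∃ k, lst (σ.Mrv (emb κ), XTn U n (emb κ)) k = σ.Srv (emb κ) d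
    · rw [if_pos hE]
      have : 0 ≤ bad (Function.update κ₀ d (κ d)) := by
        simp only [hbad]; split_ifs
        · exact (isPMF_unifp _).1 _
        · exact le_rfl
      linarith
    · rw [if_neg hE, zero_add]
      simp only [hbad]
      rw [if_pos]
      · exact le_rfl
      · intro heq
        apply hE
        refine ⟨fun l i => κ d l.1 i, ?_⟩
        have h1 := congrFun heq d
        have h2 : σ.Srv (emb (Function.update κ₀ d (κ d))) d = σ.Srv (emb κ) d := by
          simp [Strategy.Srv, emb]
        rw [h2] at h1
        rw [← h1]
        simp only [lst, Strategy.ShatRv]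
        congr 2
        · funext l i d'
          by_cases hd : d' = d
          · subst hd
            by_cases hl : l.1 ∈ U <;> simp [hl, XTn, emb]
          · simp [hd, emb]
        · funext d'
          by_cases hd : d' = d
          · subst hd
            simp [Strategy.Mrv, emb]
          · simp [hd, Strategy.Mrv, emb]
  · intro v
    have hcard : (Fintype.card ({l // l ∈ A \ U} → Fin n → Bool) : ℝ) =
        (2:ℝ) ^ (n * (A \ U).card) := by
      rw [Fintype.card_fun, Fintype.card_coe, Fintype.card_fun, Fintype.card_bool,
        Fintype.card_fin]
      push_cast
      rw [pow_mul]
    rw [← hcard]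
    exact count_list (secCard R n) d (secCard_pos R n d) (lst v) _

lemma converse {L D : ℕ} (t z : ℕ) (htL : t ≤ L) (hzt : z < t) (R : Fin D → ℝ)
    (h : Achievable (pairKeyPMF L D)
          {S : Finset (Fin L) | t ≤ S.card} {S : Finset (Fin L) | S.card ≤ z} R) (d : Fin D) :
    R d ≤ (t : ℝ) - z := by
  obtain ⟨-, σ, he, hl, hu⟩ := h
  by_contra hcon
  push Not at hcon
  obtain ⟨A, -, hA⟩ := Finset.exists_subset_card_eq (s := (Finset.univ : Finset (Fin L))) (n := t)
    (by simpa using htL)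
  obtain ⟨U, hUA, hU⟩ := Finset.exists_subset_card_eq (s := A) (n := z) (by omega)
  have hA' : A ∈ {S : Finset (Fin L) | t ≤ S.card} := hA.ge
  have hcard : (A \ U).card = t - z := by
    rw [Finset.card_sdiff_of_subset hUA, hA, hU]
  have key : ∀ n, 1 - (σ n).err (pairKeyPMF L D) A hA'
      - (((2:ℝ) ^ ((t : ℝ) - z - R d)) ^ n) / Real.log 2 ≤
      (σ n).leak (pairKeyPMF L D) U + (σ n).unif (pairKeyPMF L D) := by
    intro n
    refine le_trans ?_ (converse_step (σ n) A hA' U d)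
    apply sub_le_sub_left
    apply div_le_div_of_nonneg_right _ (Real.log_nonneg (by norm_num))
    have hM : (0:ℝ) < secCard R n d := by exact_mod_cast secCard_pos R n d
    rw [div_le_iff₀ hM]
    have h1 : (2:ℝ) ^ ((n : ℝ) * R d) ≤ secCard R n d := Nat.le_ceil _
    refine le_trans (le_of_eq ?_) (mul_le_mul_of_nonneg_left h1 (by positivity))
    rw [← Real.rpow_natCast, ← Real.rpow_natCast, ← Real.rpow_mul (by norm_num),
      ← Real.rpow_add (by norm_num), hcard, Nat.cast_mul, Nat.cast_sub hzt.le]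
    congr 1
    ring
  have hlim1 : Tendsto (fun n => 1 - (σ n).err (pairKeyPMF L D) A hA'
      - (((2:ℝ) ^ ((t : ℝ) - z - R d)) ^ n) / Real.log 2) atTop (nhds (1 - 0 - 0 / Real.log 2)) := by
    refine (tendsto_const_nhds.sub (he A hA')).sub (Tendsto.div_const ?_ _)
    apply tendsto_pow_atTop_nhds_zero_of_lt_one (by positivity)
    exact Real.rpow_lt_one_of_one_lt_of_neg (by norm_num) (by linarith)
  have hlim2 := (hl U hU.le).add hu
  have := le_of_tendsto_of_tendsto' hlim1 hlim2 key
  norm_num at this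

lemma vand {F : Type*} [Field F] {L : ℕ} (a : Fin L → F) (ha : Function.Injective a) (m : ℕ)
    (v : Fin L → F) (B : Finset (Fin L)) (hB : ∀ l, l ∉ B → v l = 0) (hcard : B.card ≤ m)
    (h : ∀ j < m, ∑ l, a l ^ j * v l = 0) : v = 0 := by
  funext l₀
  by_cases hl₀ : l₀ ∈ B
  swap
  · exact hB l₀ hl₀
  set P : Polynomial F := ∏ l ∈ B.erase l₀, (Polynomial.X - Polynomial.C (a l)) with hP
  have hdeg : P.natDegree < m := by
    rw [hP, Polynomial.natDegree_prod_of_monic _ _ (fun l _ => Polynomial.monic_X_sub_C _)]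
    simp only [Polynomial.natDegree_X_sub_C, Finset.sum_const, smul_eq_mul, mul_one]
    have := Finset.card_erase_lt_of_mem hl₀
    omega
  have h0 : ∑ l, P.eval (a l) * v l = 0 := by
    simp_rw [Polynomial.eval_eq_sum_range, Finset.sum_mul]
    rw [Finset.sum_comm]
    apply Finset.sum_eq_zero
    intro j hj
    rw [Finset.mem_range] at hj
    simp_rw [mul_assoc]
    rw [← Finset.mul_sum, h j (by omega), mul_zero]
  rw [Finset.sum_eq_single l₀] at h0
  · rcases mul_eq_zero.1 h0 with h1 | h1
    · exfalso
      rw [hP, Polynomial.eval_prod, Finset.prod_eq_zero_iff] at h1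
      obtain ⟨l, hl, h2⟩ := h1
      simp only [Polynomial.eval_sub, Polynomial.eval_X, Polynomial.eval_C, sub_eq_zero] at h2
      exact (Finset.mem_erase.1 hl).1 (ha h2).symm
    · exact h1
  · intro l _ hl
    by_cases hlB : l ∈ B
    · have : P.eval (a l) = 0 := by
        rw [hP, Polynomial.eval_prod]
        exact Finset.prod_eq_zero (Finset.mem_erase.2 ⟨hl, hlB⟩) (by simp)
      rw [this, zero_mul]
    · rw [hB l hlB, mul_zero]
  · intro h; exact absurd (Finset.mem_univ _) h

/-- Linear measurements. -/
def lin {F : Type*} [Field F] {L : ℕ} (a : Fin L → F) (y : Fin L → F) (j : ℕ) : F :=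
  ∑ l, a l ^ j * y l

lemma lin_inj {F : Type*} [Field F] {L : ℕ} (a : Fin L → F) (ha : Function.Injective a) (m : ℕ)
    (A : Finset (Fin L)) (hA : L - m ≤ A.card) (y yF : Fin L → F)
    (h1 : ∀ l ∈ A, y l = yF l) (h2 : ∀ j < m, lin a y j = lin a yF j) : y = yF := by
  have := vand a ha m (y - yF) Aᶜ (fun l hl => by
      have : l ∈ A := by simpa using hl
      simp [h1 l this]) (by rw [Finset.card_compl, Fintype.card_fin]; omega) (fun j hj => by
      have := h2 j hj
      unfold lin at this
      simp only [Pi.sub_apply, mul_sub, Finset.sum_sub_distrib, this, sub_self])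
  exact sub_eq_zero.1 this

/-- The bijection between the keys of a dealer and (secret, message, keys of the adversary). -/
lemma theta_bij {F : Type*} [Field F] [Fintype F] {L : ℕ} (a : Fin L → F)
    (ha : Function.Injective a) (t z : ℕ) (htL : t ≤ L) (hzt : z < t) (U : Finset (Fin L))
    (hU : U.card = z) :
    Function.Bijective (fun y : Fin L → F =>
      ((fun j : Fin (t - z) => lin a y (L - t + j)),
        ((fun j : Fin (L - t) => lin a y j), (fun l : {l // l ∈ U} => y l.1)))) := by
  rw [Fintype.bijective_iff_injective_and_card]
  constructor
  · intro y yF h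
    simp only [Prod.mk.injEq] at h
    obtain ⟨h1, h2, h3⟩ := h
    apply lin_inj a ha (L - z) U (by omega) y yF
    · intro l hl
      exact congrFun h3 ⟨l, hl⟩
    · intro j hj
      by_cases hjt : j < L - t
      · exact congrFun h2 ⟨j, hjt⟩
      · have := congrFun h1 ⟨j - (L - t), by omega⟩
        simp only at this
        rwa [Nat.add_sub_cancel' (by omega)] at this
  · simp only [Fintype.card_prod, Fintype.card_fun, Fintype.card_fin, Fintype.card_coe, hU]
    rw [← pow_add, ← pow_add]
    congr 1
    omega

section equivs

variable {K A B : Type*} [Fintype K] [Fintype A] [Fintype B]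

lemma prob_fst (Θ : K ≃ A × B) [Nonempty B] {S : Type*} (g : A → S) (s : S) :
    prob (unifp K) (fun κ => g (Θ κ).1) s = prob (unifp A) g s := by
  unfold prob unifp
  rw [Equiv.sum_comp Θ (fun x : A × B => if g x.1 = s then 1 / (Fintype.card K : ℝ) else 0),
    Fintype.sum_prod_type, Fintype.card_congr Θ, Fintype.card_prod]
  have : (Fintype.card B : ℝ) ≠ 0 := by exact_mod_cast Fintype.card_ne_zero
  refine Finset.sum_congr rfl fun a _ => ?_
  split_ifs
  · rw [Finset.sum_const, Finset.card_univ, nsmul_eq_mul]; push_cast; field_simp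
  · simp

lemma prob_snd (Θ : K ≃ A × B) [Nonempty A] {S : Type*} (g : B → S) (s : S) :
    prob (unifp K) (fun κ => g (Θ κ).2) s = prob (unifp B) g s :=
  prob_fst (Θ.trans (Equiv.prodComm A B)) g s

lemma prob_pair (Θ : K ≃ A × B) [Nonempty A] [Nonempty B] {S V : Type*} (g : A → S) (h : B → V)
    (s : S) (v : V) :
    prob (unifp K) (fun κ => (g (Θ κ).1, h (Θ κ).2)) (s, v) =
      prob (unifp K) (fun κ => g (Θ κ).1) s * prob (unifp K) (fun κ => h (Θ κ).2) v := by
  rw [prob_fst Θ g, prob_snd Θ h]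
  unfold prob unifp
  rw [← Equiv.sum_comp Θ.symm, Fintype.sum_prod_type, Fintype.card_congr Θ, Fintype.card_prod,
    Finset.sum_mul_sum]
  refine Finset.sum_congr rfl fun a _ => Finset.sum_congr rfl fun b _ => ?_
  by_cases h1 : g a = s <;> by_cases h2 : h b = v <;> simp [h1, h2, mul_comm]

end equivs

lemma prob_pi {D : ℕ} {A : Type*} [Fintype A] {S : Fin D → Type*} (g : ∀ d, A → S d)
    (s : ∀ d, S d) :
    prob (unifp (Fin D → A)) (fun a d => g d (a d)) s = ∏ d, prob (unifp A) (g d) (s d) := by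
  unfold prob unifp
  rw [Finset.prod_univ_sum, Fintype.piFinset_univ]
  refine Finset.sum_congr rfl fun a _ => ?_
  rw [Finset.prod_ite_zero]
  simp [funext_iff]

lemma prob_unif {A S : Type*} [Fintype A] (X : A → S) (s : S) :
    prob (unifp A) X s = ((Finset.univ.filter (fun x => X x = s)).card : ℝ) / Fintype.card A := by
  unfold prob unifp
  rw [← Finset.sum_filter, Finset.sum_const, nsmul_eq_mul, mul_one_div]

lemma prob_mod {A : Type*} [Fintype A] (M : ℕ) (hM : 0 < M) (e : A ≃ Fin (Fintype.card A))
    (c : ℕ) (hc : Fintype.card A ≤ c * M) (r : Fin M) :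
    prob (unifp A) (fun x => (⟨(e x).1 % M, Nat.mod_lt _ hM⟩ : Fin M)) r ≤
      c / (Fintype.card A : ℝ) := by
  rw [prob_unif]
  apply div_le_div_of_nonneg_right _ (Nat.cast_nonneg _)
  rw [Nat.cast_le]
  calc _ ≤ (Finset.range c).card := by
        apply Finset.card_le_card_of_injOn (fun x => (e x).1 / M)
        · intro x _
          simp only [Finset.coe_range, Set.mem_Iio]
          exact Nat.div_lt_of_lt_mul (by rw [mul_comm]; exact (e x).2.trans_le hc)
        · intro x hx y hy hxy
          simp only [Finset.coe_filter, Finset.mem_univ, true_and, Set.mem_ofPred_eq,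
            Fin.ext_iff] at hx hy
          simp only at hxy
          apply e.injective
          apply Fin.ext
          rw [← Nat.div_add_mod (e x).1 M, ← Nat.div_add_mod (e y).1 M, hx, hy, hxy]
    _ = c := Finset.card_range c

lemma ach_step {L D : ℕ} (t z : ℕ) (htL : t ≤ L) (hzt : z < t) (R : Fin D → ℝ) (n : ℕ)
    (hn : n ≠ 0) (hLn : L ≤ 2 ^ n) :
    ∃ σ : PStrategy L D {S : Finset (Fin L) | t ≤ S.card} R n,
      (∀ A hA, σ.err (pairKeyPMF L D) A hA = 0) ∧
      (∀ U : Finset (Fin L), U.card ≤ z → σ.leak (pairKeyPMF L D) U = 0) ∧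
      0 ≤ σ.unif (pairKeyPMF L D) ∧
      ∀ c : Fin D → ℕ, (∀ d, (2 ^ n) ^ (t - z) ≤ c d * secCard R n d) →
        σ.unif (pairKeyPMF L D) ≤
          ∑ d, Real.logb 2 (secCard R n d * (c d / ((2:ℝ) ^ n) ^ (t - z))) := by
  have : Fact (Nat.Prime 2) := ⟨Nat.prime_two⟩
  let F := GaloisField 2 n
  have : Fintype F := Fintype.ofFinite F
  have hF : Fintype.card F = 2 ^ n := by
    rw [← Nat.card_eq_fintype_card]; exact GaloisField.card 2 n hn
  obtain ⟨e⟩ : Nonempty ((Fin n → Bool) ≃ F) := by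
    refine ⟨Fintype.equivOfCardEq ?_⟩
    rw [hF]; simp
  obtain ⟨a⟩ : Nonempty (Fin L ↪ F) :=
    Function.Embedding.nonempty_of_card_le (by rw [hF]; simpa using hLn)
  have hcS : Fintype.card (Fin (t - z) → F) = (2 ^ n) ^ (t - z) := by simp [hF]
  let eM := Fintype.equivFin (Fin (L - t) → F)
  let eS := Fintype.equivFin (Fin (t - z) → F)
  let g : ∀ d : Fin D, (Fin (t - z) → F) → Fin (secCard R n d) := fun d x =>
    ⟨(eS x).1 % secCard R n d, Nat.mod_lt _ (secCard_pos R n d)⟩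
  let yF : (Fin n → Fin L → Bool) → Fin L → F := fun y l => e (fun i => y i l)
  let eM' : (Fin n → Fin L → Bool) → Fin (Fintype.card (Fin (L - t) → F)) :=
    fun y => eM (fun j => lin a (yF y) j)
  let eS' : ∀ d : Fin D, (Fin n → Fin L → Bool) → Fin (secCard R n d) :=
    fun d y => g d (fun j => lin a (yF y) (L - t + j))
  let σ : PStrategy L D {S : Finset (Fin L) | t ≤ S.card} R n :=
    { msgCard := fun _ => Fintype.card (Fin (L - t) → F)
      encM := fun _ => eM'
      encS := eS'
      dec := fun A _ x m d =>
        if h : ∃ y : Fin n → Fin L → Bool, (∀ l : {l // l ∈ A}, ∀ i, y i l.1 = x l i d) ∧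
          eM' y = m d then eS' d h.choose else ⟨0, secCard_pos R n d⟩ }
  have herr : ∀ A hA, σ.err (pairKeyPMF L D) A hA = 0 := by
    intro A hA
    unfold Strategy.err
    rw [sum_iid]
    apply Finset.sum_eq_zero
    intro κ _
    rw [if_neg]
    rw [not_not]
    funext d
    have hex : ∃ y : Fin n → Fin L → Bool, (∀ l : {l // l ∈ A}, ∀ i, y i l.1 = (emb κ i).1 l.1 d) ∧
          eM' y = σ.Mrv (emb κ) d := ⟨fun i => (emb κ i).2 d, fun l i => rfl, rfl⟩
    have h1 : σ.ShatRv A hA (emb κ) d = eS' d hex.choose := by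
      simp only [Strategy.ShatRv, σ]
      exact dif_pos hex
    rw [h1]
    obtain ⟨h2, h3⟩ := hex.choose_spec
    change eS' d _ = eS' d (fun i => (emb κ i).2 d)
    have h4 : yF hex.choose = yF (fun i => (emb κ i).2 d) := by
      apply lin_inj a a.injective (L - t) A (by have : t ≤ A.card := hA; omega)
      · intro l hl
        simp only [yF]
        congr 1
        funext i
        exact h2 ⟨l, hl⟩ i
      · intro j hj
        have h5 := eM.injective h3
        exact congrFun h5 ⟨j, hj⟩
    simp only [eS', h4]
  -- the global bijection
  let Θ : ∀ U : Finset (Fin L), U.card = z →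
      (Key L D n ≃ (Fin D → (Fin (t - z) → F)) × (Fin D → (Fin (L - t) → F) × ({l // l ∈ U} → F))) :=
    fun U hU => (Equiv.piCongrRight fun _ => (Equiv.piCongrRight (fun _ => e)).trans
      (Equiv.ofBijective _ (theta_bij a a.injective t z htL hzt U hU))).trans
      (Equiv.arrowProdEquivProdArrow _ _ _)
  have hΘS : ∀ U hU κ, σ.Srv (emb κ) = fun d => g d ((Θ U hU κ).1 d) := by
    intro U hU κ
    rfl
  have hleak : ∀ U : Finset (Fin L), U.card ≤ z → σ.leak (pairKeyPMF L D) U = 0 := by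
    intro U hUz
    obtain ⟨U', hUU', -, hU'⟩ := Finset.exists_subsuperset_card_eq (Finset.subset_univ U) hUz
      (by simpa using (by omega : z ≤ L))
    let h : (Fin D → (Fin (L - t) → F) × ({l // l ∈ U'} → F)) →
      ((∀ d, Fin (σ.msgCard d)) × (∀ _ : {l // l ∈ U}, Fin n → Fin D → Bool)) := fun b =>
      (fun d => eM (b d).1, fun l i d => e.symm ((b d).2 ⟨l.1, hUU' l.2⟩) i)
    have hV : ∀ κ, (σ.Mrv (emb κ), XTn U n (emb κ)) = h (Θ U' hU' κ).2 := by
      intro κ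
      refine Prod.ext rfl ?_
      funext l i d
      change κ d l.1 i = e.symm (e (κ d l.1)) i
      rw [e.symm_apply_apply]
    unfold Strategy.leak mutInf
    rw [ent_iid, ent_iid, ent_iid, ent_indep (isPMF_unifp (Key L D n))
      (fun κ => σ.Srv (emb κ)) (fun κ => (σ.Mrv (emb κ), XTn U n (emb κ)))]
    · ring
    · intro s v
      simp only [hΘS U' hU', hV]
      exact prob_pair (Θ U' hU') (fun x d => g d (x d)) h s v
  refine ⟨σ, herr, hleak, ?_, ?_⟩
  · have := leak_add_unif σ ∅ (fun _ _ => False) 0 (by intro b; simp)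
    rw [hleak ∅ (by simp)] at this
    simpa using this
  · intro c hc
    obtain ⟨U, -, hU⟩ := Finset.exists_subset_card_eq (s := (Finset.univ : Finset (Fin L)))
      (n := z) (by simpa using (by omega : z ≤ L))
    have hprob : ∀ s, prob (unifp (Key L D n)) (fun κ => σ.Srv (emb κ)) s ≤
        ∏ d, (c d / ((2:ℝ) ^ n) ^ (t - z)) := by
      intro s
      simp only [hΘS U hU]
      rw [prob_fst (Θ U hU) (fun x d => g d (x d)), prob_pi]
      apply Finset.prod_le_prod
      · intro d _; exact prob_nonneg (isPMF_unifp _) _ _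
      · intro d _
        have := prob_mod (secCard R n d) (secCard_pos R n d) eS (c d) (by rw [hcS]; exact hc d) (s d)
        have hcS' : (Fintype.card (Fin (t - z) → F) : ℝ) = ((2:ℝ) ^ n) ^ (t - z) := by
          exact_mod_cast hcS
        exact this.trans_eq (congrArg (fun x : ℝ => (c d : ℝ) / x) hcS')
    have hent := ent_lower (isPMF_unifp (Key L D n)) _ _ hprob
    unfold Strategy.unif
    rw [ent_iid]
    have hcpos : ∀ d, (0:ℝ) < c d := by
      intro d
      have h1 : 0 < c d * secCard R n d := lt_of_lt_of_le (by positivity) (hc d)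
      exact_mod_cast Nat.pos_of_mul_pos_right h1
    have hMpos : ∀ d, (0:ℝ) < secCard R n d := fun d => by exact_mod_cast secCard_pos R n d
    have h2 : ∑ d, Real.logb 2 (secCard R n d * (c d / ((2:ℝ) ^ n) ^ (t - z))) =
        Real.logb 2 (∏ d, (secCard R n d : ℝ)) +
          Real.logb 2 (∏ d, (c d / ((2:ℝ) ^ n) ^ (t - z))) := by
      rw [Real.logb_prod _ _ (fun d _ => (hMpos d).ne'),
        Real.logb_prod _ _ (fun d _ => (div_pos (hcpos d) (by positivity)).ne'),
        ← Finset.sum_add_distrib]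
      refine Finset.sum_congr rfl fun d _ => ?_
      rw [Real.logb_mul (hMpos d).ne' (div_pos (hcpos d) (by positivity)).ne']
    rw [h2]
    linarith

lemma ratio_tendsto {D : ℕ} (R : Fin D → ℝ) (d : Fin D) (t z : ℕ) (hzt : z < t)
    (hR : R d ≤ (t : ℝ) - z) :
    Tendsto (fun n : ℕ => Real.logb 2 ((secCard R n d : ℝ) *
      ((⌈(((2:ℝ) ^ n) ^ (t - z)) / secCard R n d⌉₊ : ℕ) / ((2:ℝ) ^ n) ^ (t - z)))) atTop (nhds 0) := by
  have hN : ∀ n : ℕ, ((2:ℝ) ^ n) ^ (t - z) = (2:ℝ) ^ ((n:ℝ) * ((t:ℝ) - z)) := by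
    intro n
    rw [← pow_mul, ← Real.rpow_natCast, Nat.cast_mul, Nat.cast_sub hzt.le]
  have hMpos : ∀ n, (0:ℝ) < secCard R n d := fun n => by exact_mod_cast secCard_pos R n d
  rcases hR.eq_or_lt with h | h
  · have h1 : ∀ n, (secCard R n d : ℝ) = ((2:ℝ) ^ n) ^ (t - z) := by
      intro n
      unfold secCard
      rw [h, ← hN]
      have : ((2:ℝ) ^ n) ^ (t - z) = (((2 ^ n) ^ (t - z) : ℕ) : ℝ) := by push_cast; rfl
      rw [this, Nat.ceil_natCast]
    have h2 : ∀ n : ℕ, ((2:ℝ) ^ n) ^ (t - z) ≠ 0 := fun n => by positivity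
    simp [h1, h2]
  · -- the ratio of the cardinalities vanishes
    have hlow : ∀ n, (1:ℝ) ≤ (secCard R n d : ℝ) *
      ((⌈(((2:ℝ) ^ n) ^ (t - z)) / secCard R n d⌉₊ : ℕ) / ((2:ℝ) ^ n) ^ (t - z)) := by
      intro n
      have h1 := Nat.le_ceil ((((2:ℝ) ^ n) ^ (t - z)) / secCard R n d)
      rw [div_le_iff₀ (hMpos n)] at h1
      rw [← mul_div_assoc, le_div_iff₀ (by positivity)]
      linarith
    have hup : ∀ n, (secCard R n d : ℝ) *
      ((⌈(((2:ℝ) ^ n) ^ (t - z)) / secCard R n d⌉₊ : ℕ) / ((2:ℝ) ^ n) ^ (t - z)) ≤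
        1 + (((2:ℝ) ^ (R d - ((t:ℝ) - z))) ^ n + ((2:ℝ) ^ (- ((t:ℝ) - z))) ^ n) := by
      intro n
      have h1 := (Nat.ceil_lt_add_one (a := (((2:ℝ) ^ n) ^ (t - z)) / secCard R n d)
        (by positivity)).le
      have h2 : (secCard R n d : ℝ) ≤ (2:ℝ) ^ ((n : ℝ) * R d) + 1 :=
        (Nat.ceil_lt_add_one (by positivity)).le
      have h3 : ((2:ℝ) ^ (R d - ((t:ℝ) - z))) ^ n = (2:ℝ) ^ ((n : ℝ) * R d) / ((2:ℝ) ^ n) ^ (t - z) := by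
        rw [hN, ← Real.rpow_natCast, ← Real.rpow_mul (by norm_num), ← Real.rpow_sub (by norm_num)]
        congr 1; ring
      have h4 : ((2:ℝ) ^ (- ((t:ℝ) - z))) ^ n = 1 / ((2:ℝ) ^ n) ^ (t - z) := by
        rw [hN, ← Real.rpow_natCast, ← Real.rpow_mul (by norm_num), one_div,
          ← Real.rpow_neg (by norm_num)]
        congr 1; ring
      have hNpos : (0:ℝ) < ((2:ℝ) ^ n) ^ (t - z) := by positivity
      rw [h3, h4, ← mul_div_assoc, div_le_iff₀ hNpos]
      have h5 := mul_le_mul_of_nonneg_left h1 (hMpos n).le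
      have h6 : (secCard R n d : ℝ) * ((((2:ℝ) ^ n) ^ (t - z)) / secCard R n d + 1) =
        ((2:ℝ) ^ n) ^ (t - z) + secCard R n d := by
        have := (hMpos n).ne'
        field_simp
      have h7 : (1 + ((2:ℝ) ^ ((n : ℝ) * R d) / ((2:ℝ) ^ n) ^ (t - z) +
          1 / ((2:ℝ) ^ n) ^ (t - z))) * ((2:ℝ) ^ n) ^ (t - z) =
          ((2:ℝ) ^ n) ^ (t - z) + (2:ℝ) ^ ((n : ℝ) * R d) + 1 := by
        field_simp
        ring
      linarith
    have hzt' : (z:ℝ) < t := by exact_mod_cast hzt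
    have hlim : Tendsto (fun n : ℕ => (1:ℝ) + (((2:ℝ) ^ (R d - ((t:ℝ) - z))) ^ n +
        ((2:ℝ) ^ (- ((t:ℝ) - z))) ^ n)) atTop (nhds (1 + (0 + 0))) := by
      refine tendsto_const_nhds.add (Tendsto.add ?_ ?_)
      · apply tendsto_pow_atTop_nhds_zero_of_lt_one (by positivity)
        exact Real.rpow_lt_one_of_one_lt_of_neg (by norm_num) (by linarith)
      · apply tendsto_pow_atTop_nhds_zero_of_lt_one (by positivity)
        exact Real.rpow_lt_one_of_one_lt_of_neg (by norm_num) (by linarith)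
    have h1 := tendsto_of_tendsto_of_tendsto_of_le_of_le tendsto_const_nhds
      (by simpa using hlim) hlow hup
    have h2 := (Real.continuousAt_log (x := 1) one_ne_zero).tendsto.comp h1
    rw [Real.log_one] at h2
    have h3 := h2.div_const (Real.log 2)
    rw [zero_div] at h3
    exact h3

lemma achievability {L D : ℕ} (t z : ℕ) (htL : t ≤ L) (hzt : z < t) (R : Fin D → ℝ)
    (hR0 : ∀ d, 0 ≤ R d) (hR : ∀ d, R d ≤ (t : ℝ) - z) :
    Achievable (pairKeyPMF L D)
          {S : Finset (Fin L) | t ≤ S.card} {S : Finset (Fin L) | S.card ≤ z} R := by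
  refine ⟨hR0, ?_⟩
  have hdef : ∀ n, Nonempty (PStrategy L D {S : Finset (Fin L) | t ≤ S.card} R n) := fun n =>
    ⟨{ msgCard := fun _ => 1
       encM := fun _ _ => 0
       encS := fun d _ => ⟨0, secCard_pos R n d⟩
       dec := fun _ _ _ _ d => ⟨0, secCard_pos R n d⟩ }⟩
  have hex : ∀ n, ∃ σ : PStrategy L D {S : Finset (Fin L) | t ≤ S.card} R n,
      (n ≠ 0 ∧ L ≤ 2 ^ n) → 
      (∀ A hA, σ.err (pairKeyPMF L D) A hA = 0) ∧
      (∀ U : Finset (Fin L), U.card ≤ z → σ.leak (pairKeyPMF L D) U = 0) ∧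
      0 ≤ σ.unif (pairKeyPMF L D) ∧
      ∀ c : Fin D → ℕ, (∀ d, (2 ^ n) ^ (t - z) ≤ c d * secCard R n d) →
        σ.unif (pairKeyPMF L D) ≤
          ∑ d, Real.logb 2 (secCard R n d * (c d / ((2:ℝ) ^ n) ^ (t - z))) := by
    intro n
    by_cases h : n ≠ 0 ∧ L ≤ 2 ^ n
    · obtain ⟨σ, hσ⟩ := ach_step t z htL hzt R n h.1 h.2
      exact ⟨σ, fun _ => hσ⟩
    · exact ⟨(hdef n).some, fun h' => absurd h' h⟩
  choose σ hσ using hex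
  have hev : ∀ᶠ n : ℕ in atTop, n ≠ 0 ∧ L ≤ 2 ^ n := by
    filter_upwards [eventually_ge_atTop (L + 1)] with n hn
    have := Nat.lt_two_pow_self (n := n)
    omega
  refine ⟨σ, ?_, ?_, ?_⟩
  · intro A hA
    refine tendsto_const_nhds.congr' ?_
    filter_upwards [hev] with n hn
    exact ((hσ n hn).1 A hA).symm
  · intro U hU
    refine tendsto_const_nhds.congr' ?_
    filter_upwards [hev] with n hn
    exact ((hσ n hn).2.1 U hU).symm
  · have hlim := tendsto_finsetSum (Finset.univ : Finset (Fin D))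
      (fun d _ => ratio_tendsto R d t z hzt (hR d))
    rw [Finset.sum_const_zero] at hlim
    refine tendsto_of_tendsto_of_tendsto_of_le_of_le' tendsto_const_nhds hlim ?_ ?_
    · filter_upwards [hev] with n hn
      exact (hσ n hn).2.2.1
    · filter_upwards [hev] with n hn
      refine (hσ n hn).2.2.2 (fun d => ⌈(((2:ℝ) ^ n) ^ (t - z)) / secCard R n d⌉₊) ?_
      intro d
      have hM : (0:ℝ) < secCard R n d := by exact_mod_cast secCard_pos R n d
      have h1 := Nat.le_ceil ((((2:ℝ) ^ n) ^ (t - z)) / secCard R n d)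
      rw [div_le_iff₀ hM] at h1
      exact_mod_cast h1

/-- **Theorem 7 (Capacity region for threshold access structures with pairwise
secret keys).** `C(𝔸_t, 𝕌_z) = {R ≥ 0 : R_S ≤ |S|(t − z) for all S ⊆ 𝒟}`, and
the rate tuple with all coordinates equal to `t − z` is achievable. -/
theorem threshold_capacity_pairwise_keys
    {L D : ℕ} (hL : 1 ≤ L) (hD : 1 ≤ D) (t z : ℕ)
    (ht1 : 1 ≤ t) (htL : t ≤ L) (hz1 : 1 ≤ z) (hzt : z < t) :
    (∀ R : Fin D → ℝ,
      Achievable (pairKeyPMF L D)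
          {S : Finset (Fin L) | t ≤ S.card} {S : Finset (Fin L) | S.card ≤ z} R
        ↔ ((∀ d, 0 ≤ R d) ∧
            ∀ S : Finset (Fin D), ∑ d ∈ S, R d ≤ (S.card : ℝ) * ((t : ℝ) - (z : ℝ)))) ∧
    Achievable (pairKeyPMF L D)
        {S : Finset (Fin L) | t ≤ S.card} {S : Finset (Fin L) | S.card ≤ z}
        (fun _ => (t : ℝ) - (z : ℝ)) := by
  have hach : ∀ R : Fin D → ℝ, (∀ d, 0 ≤ R d) → (∀ d, R d ≤ (t : ℝ) - z) →
      Achievable (pairKeyPMF L D)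
        {S : Finset (Fin L) | t ≤ S.card} {S : Finset (Fin L) | S.card ≤ z} R :=
    fun R h0 h1 => achievability t z htL hzt R h0 h1
  refine ⟨fun R => ⟨fun h => ⟨h.1, fun S => ?_⟩, fun h => hach R h.1 fun d => ?_⟩,
    hach _ (fun d => ?_) (fun d => le_rfl)⟩
  · refine (Finset.sum_le_sum fun d _ => converse t z htL hzt R h d).trans (le_of_eq ?_)
    rw [Finset.sum_const, nsmul_eq_mul]
  · simpa using h.2 {d}
  · have : (z : ℝ) < t := by exact_mod_cast hzt
    linarith

end SecretSharing
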